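/- Let G ∈ C, let (T,χ) be a structured tree decomposition of G, let v be a node of T, and let Y ⊆ χ(v) be a stable set with |Y| ≥ 2. Then there exist at most 4 connected components D_1, …, D_k (k ≤ 4) of G ∖ χ(v) such that Y ⊆ N(D_1) ∪ … ∪ N(D_k). -/

import Mathlib

open Set

/-- `f` enumerates an induced path on `n` vertices in `G`. -/
def IsPathEmb {α : Type} (G : SimpleGraph α) (n : ℕ) (f : Fin n → α) : Prop :=
  Function.Injective f ∧
    ∀ i j : Fin n, G.Adj (f i) (f j) ↔ (i.val = j.val + 1 ∨ j.val = i.val + 1)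

/-- `f` enumerates an induced path from `a` to `b`. -/
def IsPathFromTo {α : Type} (G : SimpleGraph α) (n : ℕ) (f : Fin n → α) (a b : α) : Prop :=
  IsPathEmb G n f ∧ ∃ h : 1 ≤ n, f ⟨0, h⟩ = a ∧ f ⟨n - 1, by omega⟩ = b

/-- The interior (internal vertices) of the path enumerated by `f`. -/
def pathInterior {α : Type} (n : ℕ) (f : Fin n → α) : Set α :=
  {v | ∃ j : Fin n, 0 < j.val ∧ j.val < n - 1 ∧ f j = v}

/-- `k` pairwise internally vertex-disjoint induced paths from `a` to `b` in `G`. -/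
def KDisjointPaths {α : Type} (G : SimpleGraph α) (k : ℕ) (a b : α) : Prop :=
  ∃ (n : Fin k → ℕ) (f : ∀ i, Fin (n i) → α),
    (∀ i, IsPathFromTo G (n i) (f i) a b) ∧
    (∀ i j, i ≠ j → Disjoint (pathInterior (n i) (f i)) (pathInterior (n j) (f j)))

/-- `f` enumerates an induced cycle on `n` vertices. -/
def IsHoleEmb {α : Type} (G : SimpleGraph α) (n : ℕ) (f : ZMod n → α) : Prop :=
  Function.Injective f ∧ ∀ i j : ZMod n, G.Adj (f i) (f j) ↔ (i = j + 1 ∨ j = i + 1)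

/-- `H` is the vertex set of a hole of `G` (an induced cycle with at least 4 vertices). -/
def IsHole {α : Type} (G : SimpleGraph α) (H : Set α) : Prop :=
  ∃ (n : ℕ) (f : ZMod n → α), 4 ≤ n ∧ IsHoleEmb G n f ∧ Set.range f = H

/-- `G` has no even hole. -/
def EvenHoleFree {α : Type} (G : SimpleGraph α) : Prop :=
  ∀ H : Set α, IsHole G H → ¬ Even H.ncard

def Anticomplete {α : Type} (G : SimpleGraph α) (A B : Set α) : Prop :=
  ∀ a ∈ A, ∀ b ∈ B, ¬ G.Adj a b

/-- `X` is a stable (independent) set of `G`. -/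
def StableSet {α : Type} (G : SimpleGraph α) (X : Set α) : Prop :=
  ∀ a ∈ X, ∀ b ∈ X, a ≠ b → ¬ G.Adj a b

/-- The open neighborhood of the set `A`. -/
def setNbhd {α : Type} (G : SimpleGraph α) (A : Set α) : Set α :=
  {v | v ∉ A ∧ ∃ a ∈ A, G.Adj v a}

/-- The set `A` induces a connected (nonempty) subgraph of `G`. -/
def ConnSet {α : Type} (G : SimpleGraph α) (A : Set α) : Prop :=
  (G.induce A).Connected

/-- `D` is a connected component of the subgraph of `G` induced by `S`. -/
def IsCompOf {α : Type} (G : SimpleGraph α) (S D : Set α) : Prop :=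
  D ⊆ S ∧ ConnSet G D ∧ ∀ D', D ⊆ D' → D' ⊆ S → ConnSet G D' → D' = D

/-- `G` contains an (induced) theta. -/
def HasTheta {α : Type} (G : SimpleGraph α) : Prop :=
  ∃ (a b : α) (n : Fin 3 → ℕ) (f : ∀ i, Fin (n i) → α),
    a ≠ b ∧ ¬ G.Adj a b ∧ (∀ i, 3 ≤ n i) ∧
    (∀ i, IsPathFromTo G (n i) (f i) a b) ∧
    (∀ i j : Fin 3, i ≠ j → ∀ (u : Fin (n i)) (v : Fin (n j)),
      0 < u.val → u.val < n i - 1 → 0 < v.val → v.val < n j - 1 →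
      f i u ≠ f j v ∧ ¬ G.Adj (f i u) (f j v))

/-- `G` contains an (induced) prism. -/
def HasPrism {α : Type} (G : SimpleGraph α) : Prop :=
  ∃ (n : Fin 3 → ℕ) (f : ∀ i, Fin (n i) → α),
    (∀ i, 2 ≤ n i) ∧ (∀ i, IsPathEmb G (n i) (f i)) ∧
    (∀ i j : Fin 3, i ≠ j → ∀ u v, f i u ≠ f j v) ∧
    (∀ i j : Fin 3, i ≠ j → ∀ (u : Fin (n i)) (v : Fin (n j)),
      G.Adj (f i u) (f j v) ↔
        ((u.val = 0 ∧ v.val = 0) ∨ (u.val = n i - 1 ∧ v.val = n j - 1)))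

/-- The neighbors of `x` in the hole `H`. -/
def holeNbrs {α : Type} (G : SimpleGraph α) (H : Set α) (x : α) : Set α :=
  {v ∈ H | G.Adj x v}

def IsWheel {α : Type} (G : SimpleGraph α) (H : Set α) (x : α) : Prop :=
  IsHole G H ∧ x ∉ H ∧ 3 ≤ (holeNbrs G H x).ncard

def IsTwinWheel {α : Type} (G : SimpleGraph α) (H : Set α) (x : α) : Prop :=
  IsWheel G H x ∧ ∃ p q r : α, p ≠ q ∧ q ≠ r ∧ p ≠ r ∧
    holeNbrs G H x = {p, q, r} ∧ G.Adj p q ∧ G.Adj q r ∧ ¬ G.Adj p r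

def IsShortPyramid {α : Type} (G : SimpleGraph α) (H : Set α) (x : α) : Prop :=
  IsWheel G H x ∧ ∃ p q r : α, p ≠ q ∧ q ≠ r ∧ p ≠ r ∧
    holeNbrs G H x = {p, q, r} ∧ G.Adj p q ∧ ¬ G.Adj q r ∧ ¬ G.Adj p r

def IsProperWheel {α : Type} (G : SimpleGraph α) (H : Set α) (x : α) : Prop :=
  IsWheel G H x ∧ ¬ IsTwinWheel G H x ∧ ¬ IsShortPyramid G H x

/-- `x` is a hub of the induced subgraph `G[W]`. -/
def IsHubIn {α : Type} (G : SimpleGraph α) (W : Set α) (x : α) : Prop :=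
  x ∈ W ∧ ∃ H : Set α, H ⊆ W ∧ IsProperWheel G H x

/-- `x` is a hub of `G`: the center of some proper wheel. -/
def IsHub {α : Type} (G : SimpleGraph α) (x : α) : Prop :=
  ∃ H : Set α, IsProperWheel G H x

/-- membership in the class `𝒞` of (C₄, theta, prism, even wheel)-free graphs. -/
def MemC {α : Type} (G : SimpleGraph α) : Prop :=
  (∀ H : Set α, IsHole G H → H.ncard ≠ 4) ∧ ¬ HasTheta G ∧ ¬ HasPrism G ∧
    (∀ (H : Set α) (x : α), IsWheel G H x → ¬ Even (holeNbrs G H x).ncard)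

/-- membership in the class `𝒞ₜ`: graphs in `𝒞` with no clique of size `t`. -/
def MemCt {α : Type} (t : ℕ) (G : SimpleGraph α) : Prop :=
  MemC G ∧ G.CliqueFree t

/-- `G` contains a generalized `k`-pyramid as an induced subgraph. -/
def ContainsGenPyramid {α : Type} (G : SimpleGraph α) (k : ℕ) : Prop :=
  ∃ (nP nQ : ℕ) (P : Fin nP → α) (Q : Fin nQ → α)
    (m : Fin k → ℕ) (R : ∀ i, Fin (m i) → α) (xI zI : Fin k → ℕ),
    4 ≤ nP + nQ ∧ 1 ≤ nP ∧ 1 ≤ nQ ∧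
    IsPathEmb G nP P ∧ IsPathEmb G nQ Q ∧
    (∀ i j, P i ≠ Q j) ∧
    (∀ (i : Fin nP) (j : Fin nQ), G.Adj (P i) (Q j) ↔
      ((i.val = 0 ∧ j.val = 0) ∨ (i.val = nP - 1 ∧ j.val = nQ - 1))) ∧
    (∀ i, 1 ≤ m i) ∧ (∀ i, IsPathEmb G (m i) (R i)) ∧
    (∀ i u j, R i u ≠ P j) ∧ (∀ i u j, R i u ≠ Q j) ∧
    (∀ i i', i ≠ i' → ∀ u u', R i u ≠ R i' u' ∧ ¬ G.Adj (R i u) (R i' u')) ∧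
    (∀ i, 0 < xI i ∧ xI i + 1 < nP - 1) ∧
    (∀ (i : Fin k) (u : Fin (m i)) (j : Fin nP), G.Adj (R i u) (P j) ↔
      (u.val = 0 ∧ (j.val = xI i ∨ j.val = xI i + 1))) ∧
    (∀ i, zI i < nQ) ∧
    (∀ (i : Fin k) (u : Fin (m i)) (j : Fin nQ), G.Adj (R i u) (Q j) ↔
      (u.val = m i - 1 ∧ j.val = zI i)) ∧
    (∀ i i' : Fin k, i < i' → xI i + 1 < xI i') ∧
    (∀ i i' : Fin k, i ≤ i' → zI i ≤ zI i')

/-- membership in the class `𝒞ₜₜ`: graphs in `𝒞ₜ` with no induced generalized `t`-pyramid. -/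
def MemCtt {α : Type} (t : ℕ) (G : SimpleGraph α) : Prop :=
  MemCt t G ∧ ¬ ContainsGenPyramid G t

/-- `(T, χ)` is a tree decomposition of `G`. -/
structure IsTD {α ι : Type} (G : SimpleGraph α) (T : SimpleGraph ι) (χ : ι → Set α) : Prop where
  finite : Finite ι
  isTree : T.IsTree
  memBag : ∀ v : α, ∃ t, v ∈ χ t
  edgeBag : ∀ ⦃u v : α⦄, G.Adj u v → ∃ t, u ∈ χ t ∧ v ∈ χ t
  subtree : ∀ v : α, (T.induce {t | v ∈ χ t}).Connected

/-- `G` has a tree decomposition of width at most `w`. -/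
def TwLE {α : Type} (G : SimpleGraph α) (w : ℕ) : Prop :=
  ∃ (ι : Type) (T : SimpleGraph ι) (χ : ι → Set α),
    IsTD G T χ ∧ ∀ t, (χ t).ncard ≤ w + 1

/-- The treewidth of `G`. -/
noncomputable def treeWidth {α : Type} (G : SimpleGraph α) : ℕ :=
  sInf {w | TwLE G w}

/-- For adjacent `t, t'` in a tree `T`, the vertex set of the component of `T - t`
containing `t'`. -/
def branchSet {ι : Type} (T : SimpleGraph ι) (t t' : ι) : Set ι :=
  {s | ∀ w : T.Walk s t, t' ∈ w.support}

/-- The vertex set of `G_{t → t'}`: the union of the bags over the component of `T - t`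
containing `t'`. -/
def sideSet {α ι : Type} (T : SimpleGraph ι) (χ : ι → Set α) (t t' : ι) : Set α :=
  ⋃ s ∈ branchSet T t t', χ s

/-- `(T, χ)` is a tight tree decomposition of `G`. -/
def TightTD {α ι : Type} (G : SimpleGraph α) (T : SimpleGraph ι) (χ : ι → Set α) : Prop :=
  IsTD G T χ ∧ ∀ ⦃t t' : ι⦄, T.Adj t t' →
    ∃ D, IsCompOf G (sideSet T χ t t' \ χ t) D ∧ setNbhd G D = χ t ∩ χ t'

/-- `G` admits a clique cutset. -/
def HasCliqueCutset {α : Type} (G : SimpleGraph α) : Prop :=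
  ∃ C : Set α, G.IsClique C ∧ ¬ (G.induce (Set.univ \ C)).Preconnected

/-- `G` is chordal: it has no hole. -/
def ChordalG {α : Type} (G : SimpleGraph α) : Prop := ∀ H : Set α, ¬ IsHole G H

/-- `G'` is a minimal chordal completion of `G`. -/
def IsMinChordalCompletion {α : Type} (G G' : SimpleGraph α) : Prop :=
  G ≤ G' ∧ ChordalG G' ∧ ∀ G'', G ≤ G'' → G'' ≤ G' → ChordalG G'' → G'' = G'

/-- `Ω` is a potential maximal clique of `G` : a maximal clique of some minimal chordal
completion of `G`. -/
def IsPMC {α : Type} (G : SimpleGraph α) (Ω : Set α) : Prop :=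
  ∃ G' : SimpleGraph α, IsMinChordalCompletion G G' ∧ G'.IsClique Ω ∧
    ∀ Ω' : Set α, G'.IsClique Ω' → Ω ⊆ Ω' → Ω' = Ω

/-- `(T, χ)` is a structured tree decomposition: every bag is a PMC of `G`. -/
def StructuredTD {α ι : Type} (G : SimpleGraph α) (T : SimpleGraph ι) (χ : ι → Set α) : Prop :=
  IsTD G T χ ∧ ∀ t, IsPMC G (χ t)

/-- the decomposition has adhesion less than `m`. -/
def AdhLT {α ι : Type} (T : SimpleGraph ι) (χ : ι → Set α) (m : ℕ) : Prop :=
  ∀ ⦃t t' : ι⦄, T.Adj t t' → (χ t ∩ χ t').ncard < m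

/-- `fatness χ i` is the number of bags of size `i`. -/
noncomputable def fatness {α ι : Type} (χ : ι → Set α) (i : ℕ) : ℕ :=
  {t : ι | (χ t).ncard = i}.ncard

/-- Lexicographic comparison of fatness vectors `(aₙ, …, a₀)` (larger sizes more
significant). -/
def FatLexLE (f g : ℕ → ℕ) : Prop :=
  (∀ i, f i = g i) ∨ ∃ j, f j < g j ∧ ∀ i, j < i → f i = g i

/-- `(T, χ)` is an `m`-atomic tree decomposition of `G`: its adhesion is less than `m` and its
fatness is lexicographically minimum among all tree decompositions with adhesion less than `m`. -/
def IsAtomicTD {α ι : Type} (m : ℕ) (G : SimpleGraph α) (T : SimpleGraph ι)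
    (χ : ι → Set α) : Prop :=
  IsTD G T χ ∧ AdhLT T χ m ∧
    ∀ (ι' : Type) (T' : SimpleGraph ι') (χ' : ι' → Set α),
      IsTD G T' χ' → AdhLT T' χ' m → FatLexLE (fatness χ) (fatness χ')

/-- Adjacency in the torso at the node `x` of the tree decomposition. -/
def torsoAdj {α ι : Type} (G : SimpleGraph α) (T : SimpleGraph ι) (χ : ι → Set α)
    (x : ι) (u v : α) : Prop :=
  u ∈ χ x ∧ v ∈ χ x ∧ u ≠ v ∧
    (G.Adj u v ∨ ∃ y, T.Adj x y ∧ u ∈ χ y ∧ v ∈ χ y)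

/-- The degree of `u` in the torso at `x`. -/
noncomputable def torsoDeg {α ι : Type} (G : SimpleGraph α) (T : SimpleGraph ι)
    (χ : ι → Set α) (x : ι) (u : α) : ℕ :=
  {v | torsoAdj G T χ x u v}.ncard

/-- `u` and `v` lie in the same component of `G[S]`. -/
def SameComp {α : Type} (G : SimpleGraph α) (S : Set α) (u v : α) : Prop :=
  ∃ (hu : u ∈ S) (hv : v ∈ S), (G.induce S).Reachable ⟨u, hu⟩ ⟨v, hv⟩

/-- `X` is a minimal separator of `G`. -/
def IsMinimalSeparator {α : Type} (G : SimpleGraph α) (X : Set α) : Prop :=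
  ∃ u v : α, u ∉ X ∧ v ∉ X ∧ ¬ SameComp G (Set.univ \ X) u v ∧
    ∀ Y : Set α, Y ⊂ X → SameComp G (Set.univ \ Y) u v
/-- The degree of `v` in `H` (as the cardinality of its neighbor set). -/
noncomputable def degreeSet {α : Type} (H : SimpleGraph α) (v : α) : ℕ :=
  (H.neighborSet v).ncard

/-- `H` is a path (as a graph). -/
def IsPathGraph {α : Type} (H : SimpleGraph α) : Prop :=
  ∃ (n : ℕ) (f : Fin n → α), Function.Bijective f ∧
    ∀ i j, H.Adj (f i) (f j) ↔ (i.val = j.val + 1 ∨ j.val = i.val + 1)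

/-- `H` is a caterpillar: a tree of maximum degree three having a path containing all
branch vertices. -/
def IsCaterpillar {α : Type} (H : SimpleGraph α) : Prop :=
  H.IsTree ∧ (∀ v, degreeSet H v ≤ 3) ∧
    ∃ (n : ℕ) (f : Fin n → α), IsPathEmb H n f ∧
      ∀ v, 2 < degreeSet H v → v ∈ Set.range f

/-- `H` is a subdivided star: a tree with exactly one branch vertex (its root), of degree
at least 3. -/
def IsSubdividedStar {α : Type} (H : SimpleGraph α) : Prop :=
  H.IsTree ∧ ∃! r, 2 < degreeSet H r

/-- `H` is (isomorphic to) the line graph of a caterpillar. -/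
def IsLineGraphOfCaterpillar {α : Type} (H : SimpleGraph α) : Prop :=
  ∃ (β : Type) (C : SimpleGraph β), IsCaterpillar C ∧
    Nonempty (SimpleGraph.Iso H C.lineGraph)

/-- `w` is a simplicial vertex of the induced subgraph `G[W]`. -/
def SimplicialIn {α : Type} (G : SimpleGraph α) (W : Set α) (w : α) : Prop :=
  w ∈ W ∧ G.IsClique {u | u ∈ W ∧ G.Adj w u}

/-- `(p, x)` is an alignment: `p` enumerates an induced path, `x` enumerates the set `X`
in the order given by the alignment. -/
structure IsAlignment {α : Type} (G : SimpleGraph α) (n : ℕ) (p : Fin n → α)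
    (k : ℕ) (x : Fin k → α) : Prop where
  hn : 1 ≤ n
  hk : 2 ≤ k
  path : IsPathEmb G n p
  injx : Function.Injective x
  disj : ∀ i j, x i ≠ p j
  cover : ∀ i, ∃ j, G.Adj (x i) (p j)
  first : ∀ j : Fin n, G.Adj (x ⟨0, by omega⟩) (p j) ↔ j.val = 0
  last : ∀ j : Fin n, G.Adj (x ⟨k - 1, by omega⟩) (p j) ↔ j.val = n - 1
  ordered : ∀ (i i' : Fin k) (j j' : Fin n),
    i < i' → G.Adj (x i) (p j) → G.Adj (x i') (p j') → j < j'

/-- A wide alignment: every middle vertex of `X` has two non-adjacent neighbors in `P`. -/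
def IsWideAlignment {α : Type} (G : SimpleGraph α) (n : ℕ) (p : Fin n → α)
    (k : ℕ) (x : Fin k → α) : Prop :=
  IsAlignment G n p k x ∧ ∀ i : Fin k, 0 < i.val → i.val < k - 1 →
    ∃ j j' : Fin n, j.val + 1 < j'.val ∧ G.Adj (x i) (p j) ∧ G.Adj (x i) (p j')

/-- A spiky alignment: every middle vertex of `X` has a unique neighbor in `P`. -/
def IsSpikyAlignment {α : Type} (G : SimpleGraph α) (n : ℕ) (p : Fin n → α)
    (k : ℕ) (x : Fin k → α) : Prop :=
  IsAlignment G n p k x ∧ ∀ i : Fin k, 0 < i.val → i.val < k - 1 →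
    ∃! j : Fin n, G.Adj (x i) (p j)

/-- A triangular alignment: every middle vertex of `X` has exactly two neighbors in `P`,
and they are adjacent. -/
def IsTriangularAlignment {α : Type} (G : SimpleGraph α) (n : ℕ) (p : Fin n → α)
    (k : ℕ) (x : Fin k → α) : Prop :=
  IsAlignment G n p k x ∧ ∀ i : Fin k, 0 < i.val → i.val < k - 1 →
    ∃ j : Fin n, j.val + 1 < n ∧
      ∀ j' : Fin n, G.Adj (x i) (p j') ↔ (j'.val = j.val ∨ j'.val = j.val + 1)

/-- `(H, x)` is a spiky connectifier: `H` is an induced caterpillar with spine `p` and legs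
`ℓ`, and `x` enumerates `X` in the order given by the connectifier (`x 0` and `x (k-1)`
attached at the ends of the spine, the others to the tips of the legs, in the order in which
the legs attach along the spine). -/
def IsSpikyConnectifier {α : Type} (G : SimpleGraph α) (H : Set α)
    (k : ℕ) (x : Fin k → α) : Prop :=
  ∃ (hk : 2 ≤ k) (n : ℕ) (_ : 2 ≤ n) (p : Fin n → α)
    (m : Fin (k - 2) → ℕ) (ℓ : ∀ i, Fin (m i) → α) (a : Fin (k - 2) → ℕ),
    IsPathEmb G n p ∧ (∀ i, 1 ≤ m i) ∧ (∀ i, IsPathEmb G (m i) (ℓ i)) ∧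
    H = Set.range p ∪ ⋃ i, Set.range (ℓ i) ∧
    Function.Injective x ∧ (∀ i, x i ∉ H) ∧
    (∀ i j j', ℓ i j ≠ p j') ∧
    (∀ i i', i ≠ i' → ∀ j j', ℓ i j ≠ ℓ i' j' ∧ ¬ G.Adj (ℓ i j) (ℓ i' j')) ∧
    (∀ i, 0 < a i ∧ a i < n - 1) ∧
    (∀ i i', i < i' → a i < a i') ∧
    (∀ (i : Fin (k - 2)) (j : Fin (m i)) (j' : Fin n),
      G.Adj (ℓ i j) (p j') ↔ (j.val = 0 ∧ j'.val = a i)) ∧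
    (∀ j : Fin n, G.Adj (x ⟨0, by omega⟩) (p j) ↔ j.val = 0) ∧
    (∀ (i : Fin (k - 2)) (j : Fin (m i)), ¬ G.Adj (x ⟨0, by omega⟩) (ℓ i j)) ∧
    (∀ j : Fin n, G.Adj (x ⟨k - 1, by omega⟩) (p j) ↔ j.val = n - 1) ∧
    (∀ (i : Fin (k - 2)) (j : Fin (m i)), ¬ G.Adj (x ⟨k - 1, by omega⟩) (ℓ i j)) ∧
    (∀ (i : Fin (k - 2)) (j : Fin n),
      ¬ G.Adj (x ⟨i.val + 1, by have := i.isLt; omega⟩) (p j)) ∧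
    (∀ (i i' : Fin (k - 2)) (j : Fin (m i')),
      G.Adj (x ⟨i.val + 1, by have := i.isLt; omega⟩) (ℓ i' j) ↔ (i' = i ∧ j.val = m i' - 1))

/-- `(H, x)` is a triangular connectifier: `H` is the line graph of a caterpillar, with
spine `p` and legs `ℓ` attached along triangles, and `x` enumerates `X` in the order given
by the connectifier. -/
def IsTriangularConnectifier {α : Type} (G : SimpleGraph α) (H : Set α)
    (k : ℕ) (x : Fin k → α) : Prop :=
  ∃ (hk : 2 ≤ k) (n : ℕ) (_ : 2 ≤ n) (p : Fin n → α)
    (m : Fin (k - 2) → ℕ) (ℓ : ∀ i, Fin (m i) → α) (a : Fin (k - 2) → ℕ),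
    IsPathEmb G n p ∧ (∀ i, 1 ≤ m i) ∧ (∀ i, IsPathEmb G (m i) (ℓ i)) ∧
    H = Set.range p ∪ ⋃ i, Set.range (ℓ i) ∧
    Function.Injective x ∧ (∀ i, x i ∉ H) ∧
    (∀ i j j', ℓ i j ≠ p j') ∧
    (∀ i i', i ≠ i' → ∀ j j', ℓ i j ≠ ℓ i' j' ∧ ¬ G.Adj (ℓ i j) (ℓ i' j')) ∧
    (∀ i, a i + 1 ≤ n - 1) ∧
    (∀ i i', i < i' → a i < a i') ∧
    (∀ (i : Fin (k - 2)) (j : Fin (m i)) (j' : Fin n),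
      G.Adj (ℓ i j) (p j') ↔ (j.val = 0 ∧ (j'.val = a i ∨ j'.val = a i + 1))) ∧
    (∀ j : Fin n, G.Adj (x ⟨0, by omega⟩) (p j) ↔ j.val = 0) ∧
    (∀ (i : Fin (k - 2)) (j : Fin (m i)), ¬ G.Adj (x ⟨0, by omega⟩) (ℓ i j)) ∧
    (∀ j : Fin n, G.Adj (x ⟨k - 1, by omega⟩) (p j) ↔ j.val = n - 1) ∧
    (∀ (i : Fin (k - 2)) (j : Fin (m i)), ¬ G.Adj (x ⟨k - 1, by omega⟩) (ℓ i j)) ∧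
    (∀ (i : Fin (k - 2)) (j : Fin n),
      ¬ G.Adj (x ⟨i.val + 1, by have := i.isLt; omega⟩) (p j)) ∧
    (∀ (i i' : Fin (k - 2)) (j : Fin (m i')),
      G.Adj (x ⟨i.val + 1, by have := i.isLt; omega⟩) (ℓ i' j) ↔ (i' = i ∧ j.val = m i' - 1))

/-- `(H, x)` is a stellar connectifier: `H` is an induced subdivided star with root `r` and
legs `ℓ`, and the vertices of `X` are attached to the tips of the legs. -/
def IsStellarConnectifier {α : Type} (G : SimpleGraph α) (H : Set α)
    (k : ℕ) (x : Fin k → α) : Prop :=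
  ∃ (_ : 3 ≤ k) (r : α) (m : Fin k → ℕ) (ℓ : ∀ i, Fin (m i) → α),
    (∀ i, 1 ≤ m i) ∧ (∀ i, IsPathEmb G (m i) (ℓ i)) ∧
    H = {r} ∪ ⋃ i, Set.range (ℓ i) ∧
    Function.Injective x ∧ (∀ i, x i ∉ H) ∧
    (∀ i j, ℓ i j ≠ r) ∧
    (∀ i i', i ≠ i' → ∀ j j', ℓ i j ≠ ℓ i' j' ∧ ¬ G.Adj (ℓ i j) (ℓ i' j')) ∧
    (∀ (i : Fin k) (j : Fin (m i)), G.Adj r (ℓ i j) ↔ j.val = 0) ∧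
    (∀ i, ¬ G.Adj (x i) r) ∧
    (∀ (i i' : Fin k) (j : Fin (m i')),
      G.Adj (x i) (ℓ i' j) ↔ (i' = i ∧ j.val = m i' - 1))

/-- `(H, X)` is a wide alignment (set version). -/
def IsWideAlignSet {α : Type} (G : SimpleGraph α) (H X : Set α) : Prop :=
  ∃ (n k : ℕ) (p : Fin n → α) (e : Fin k → α),
    H = Set.range p ∧ X = Set.range e ∧ IsWideAlignment G n p k e

/-- `(H, X)` is a spiky alignment (set version). -/
def IsSpikyAlignSet {α : Type} (G : SimpleGraph α) (H X : Set α) : Prop :=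
  ∃ (n k : ℕ) (p : Fin n → α) (e : Fin k → α),
    H = Set.range p ∧ X = Set.range e ∧ IsSpikyAlignment G n p k e

/-- `(H, X)` is a triangular alignment (set version). -/
def IsTriAlignSet {α : Type} (G : SimpleGraph α) (H X : Set α) : Prop :=
  ∃ (n k : ℕ) (p : Fin n → α) (e : Fin k → α),
    H = Set.range p ∧ X = Set.range e ∧ IsTriangularAlignment G n p k e

/-- `(H, X)` is a spiky connectifier (set version). -/
def IsSpikyConnSet {α : Type} (G : SimpleGraph α) (H X : Set α) : Prop :=
  ∃ (k : ℕ) (e : Fin k → α), X = Set.range e ∧ IsSpikyConnectifier G H k e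

/-- `(H, X)` is a triangular connectifier (set version). -/
def IsTriConnSet {α : Type} (G : SimpleGraph α) (H X : Set α) : Prop :=
  ∃ (k : ℕ) (e : Fin k → α), X = Set.range e ∧ IsTriangularConnectifier G H k e

/-- `(H, X)` is a stellar connectifier (set version). -/
def IsStellarConnSet {α : Type} (G : SimpleGraph α) (H X : Set α) : Prop :=
  ∃ (k : ℕ) (e : Fin k → α), X = Set.range e ∧ IsStellarConnectifier G H k e

/-- `(H, X)` (with order `e` on `X`) is a consistent alignment or consistent connectifier. -/
def IsConsistentWith {α : Type} (G : SimpleGraph α) (H : Set α)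
    (k : ℕ) (e : Fin k → α) : Prop :=
  (∃ (n : ℕ) (p : Fin n → α), H = Set.range p ∧
    (IsWideAlignment G n p k e ∨ IsSpikyAlignment G n p k e ∨ IsTriangularAlignment G n p k e)) ∨
  IsSpikyConnectifier G H k e ∨ IsTriangularConnectifier G H k e ∨
    IsStellarConnectifier G H k e

section Components

variable {α : Type} {G : SimpleGraph α}

theorem IsCompOf.exists_mem [Finite α] {S : Set α} {v : α} (hv : v ∈ S) :
    ∃ D, IsCompOf G S D ∧ v ∈ D := by
  have hfin : {D : Set α | v ∈ D ∧ D ⊆ S ∧ ConnSet G D}.Finite := Set.toFinite _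
  have hne : {D : Set α | v ∈ D ∧ D ⊆ S ∧ ConnSet G D}.Nonempty := by
    refine ⟨{v}, rfl, by simpa using hv, ?_⟩
    have : Subsingleton ({v} : Set α) := inferInstance
    exact { preconnected := SimpleGraph.Preconnected.of_subsingleton, nonempty := ⟨⟨v, rfl⟩⟩ }
  obtain ⟨D, ⟨hvD, hDS, hconn⟩, hmax⟩ := hfin.exists_maximal hne
  exact ⟨D, ⟨hDS, hconn, fun D' h1 h2 h3 =>
    Set.Subset.antisymm (hmax ⟨h1 hvD, h2, h3⟩ h1) h1⟩, hvD⟩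

theorem IsCompOf.mem_of_adj {S D : Set α} (hD : IsCompOf G S D) {u v : α}
    (hu : u ∈ D) (hv : v ∈ S) (huv : G.Adj u v) : v ∈ D := by
  have hpair : ConnSet G {u, v} := SimpleGraph.induce_pair_connected_of_adj huv
  have hconn : ConnSet G (D ∪ {u, v}) :=
    SimpleGraph.induce_union_connected hD.2.1.preconnected hpair.preconnected
      ⟨u, hu, by simp⟩
  have := hD.2.2 _ Set.subset_union_left
    (Set.union_subset hD.1 (by rintro z (rfl | rfl); exacts [hD.1 hu, hv])) hconn
  rw [← this]
  simp

theorem IsCompOf.eq_of_mem {S D D' : Set α} (hD : IsCompOf G S D) (hD' : IsCompOf G S D')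
    {u : α} (hu : u ∈ D) (hu' : u ∈ D') : D = D' := by
  have hconn : ConnSet G (D ∪ D') :=
    SimpleGraph.induce_union_connected hD.2.1.preconnected hD'.2.1.preconnected ⟨u, hu, hu'⟩
  have hsub := Set.union_subset hD.1 hD'.1
  rw [← hD.2.2 _ Set.subset_union_left hsub hconn]
  exact hD'.2.2 _ Set.subset_union_right hsub hconn

end Components

section PotentialMaximalCliques

variable {α : Type}

/-- A walk leaving `D ∪ N` from inside `D` passes through `N` on its way, if all the edges
leaving `D` end in `N`. -/
theorem exists_mem_of_leaves {K : SimpleGraph α} {D N : Set α}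
    (hDN : ∀ u ∈ D, ∀ v, K.Adj u v → v ∈ D ∪ N) (g : ℕ → α) (hg : ∀ k, K.Adj (g k) (g (k + 1)))
    (h0 : g 0 ∈ D) {j : ℕ} (hj : g j ∉ D ∪ N) : ∃ p, 0 < p ∧ p < j ∧ g p ∈ N := by
  by_contra! hcon
  have key : ∀ k, k < j → g k ∈ D := by
    intro k
    induction k with
    | zero => exact fun _ => h0
    | succ k ih =>
      intro hk
      exact (hDN _ (ih (by omega)) _ (hg k)).resolve_right (hcon _ (by omega) hk)
  rcases j with _ | j
  · exact hj (Or.inl h0)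
  · exact hj (hDN _ (key j (by omega)) _ (hg j))

theorem natCast_zmod_ne {n a b : ℕ} (hab : a < b) (hb : b < n + a) :
    (a : ZMod n) ≠ (b : ZMod n) := by
  intro h
  have h1 := (ZMod.natCast_eq_natCast_iff _ _ _).1 h
  have h2 := (Nat.modEq_iff_dvd' hab.le).1 h1
  have := Nat.le_of_dvd (by omega) h2
  omega

/-- A hole meeting `D` stays in `D ∪ N`, if `N` is a clique that separates `D` from the rest. -/
theorem IsHoleEmb.mem_of_clique_separates {K : SimpleGraph α} {D N : Set α} (hN : K.IsClique N)
    (hDN : ∀ u ∈ D, ∀ v, K.Adj u v → v ∈ D ∪ N) {n : ℕ} (hn : 4 ≤ n) {f : ZMod n → α}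
    (hf : IsHoleEmb K n f) {i₀ : ZMod n} (hi₀ : f i₀ ∈ D) (i : ZMod n) : f i ∈ D ∪ N := by
  by_contra hi
  have : NeZero n := ⟨by omega⟩
  have hj : ((i - i₀).val : ZMod n) = i - i₀ := ZMod.natCast_zmod_val _
  have hjn : (i - i₀).val < n := ZMod.val_lt _
  generalize (i - i₀).val = j at hj hjn
  obtain ⟨p, hp0, hpj, hp⟩ := exists_mem_of_leaves hDN (fun k => f (i₀ + k))
    (fun k => (hf.2 _ _).2 (Or.inr (by push_cast; ring))) (by simpa using hi₀) (j := j)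
    (by simpa [hj] using hi)
  obtain ⟨q, hq0, hqj, hq⟩ := exists_mem_of_leaves hDN (fun k => f (i₀ - k))
    (fun k => (hf.2 _ _).2 (Or.inl (by push_cast; ring))) (by simpa using hi₀) (j := n - j)
    (by
      have : i₀ - ((n - j : ℕ) : ZMod n) = i := by
        rw [Nat.cast_sub hjn.le, hj]; simp
      simpa [this] using hi)
  have hne : f (i₀ + p) ≠ f (i₀ - q) := by
    intro h
    refine natCast_zmod_ne (n := n) (a := 0) (b := p + q) (by omega) (by omega) ?_
    push_cast
    linear_combination -(hf.1 h)
  rcases (hf.2 _ _).1 (hN hp hq hne) with h | h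
  · refine natCast_zmod_ne (n := n) (a := 1) (b := p + q) (by omega) (by omega) ?_
    push_cast
    linear_combination -h
  · refine natCast_zmod_ne (n := n) (a := 0) (b := p + q + 1) (by omega) (by omega) ?_
    push_cast
    linear_combination h

/-- The graph obtained from `G'` by deleting the edge `xy` and every edge from a component of
`G ∖ Ω` to a vertex outside of its closed neighborhood in `G`. -/
def trimCompletion (G G' : SimpleGraph α) (Ω : Set α) (x y : α) : SimpleGraph α where
  Adj u v := G'.Adj u v ∧ ¬ (u = x ∧ v = y) ∧ ¬ (u = y ∧ v = x) ∧
    ∀ D, IsCompOf G (Set.univ \ Ω) D →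
      (u ∈ D → v ∈ D ∪ setNbhd G D) ∧ (v ∈ D → u ∈ D ∪ setNbhd G D)
  symm := ⟨fun _ _ h => ⟨h.1.symm, fun e => h.2.2.1 ⟨e.2, e.1⟩, fun e => h.2.1 ⟨e.2, e.1⟩,
    fun D hD => ⟨(h.2.2.2 D hD).2, (h.2.2.2 D hD).1⟩⟩⟩
  loopless := ⟨fun _ h => h.1.ne rfl⟩

theorem mem_union_setNbhd {G : SimpleGraph α} {D : Set α} {u v : α} (hu : u ∈ D)
    (h : G.Adj u v) : v ∈ D ∪ setNbhd G D := by
  by_cases hv : v ∈ D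
  · exact Or.inl hv
  · exact Or.inr ⟨hv, u, hu, h.symm⟩

theorem setNbhd_comp_subset {G : SimpleGraph α} {Ω D : Set α}
    (hD : IsCompOf G (Set.univ \ Ω) D) : setNbhd G D ⊆ Ω := by
  rintro v ⟨hv, u, hu, huv⟩
  by_contra hvΩ
  exact hv (hD.mem_of_adj hu ⟨trivial, hvΩ⟩ huv.symm)

theorem le_trimCompletion {G G' : SimpleGraph α} {Ω : Set α} {x y : α} (hGG' : G ≤ G')
    (hxy : ¬ G.Adj x y) : G ≤ trimCompletion G G' Ω x y := by
  intro u v huv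
  refine ⟨hGG' huv, ?_, ?_, fun D _ => ⟨fun h => mem_union_setNbhd h huv,
    fun h => mem_union_setNbhd h huv.symm⟩⟩
  · rintro ⟨rfl, rfl⟩; exact hxy huv
  · rintro ⟨rfl, rfl⟩; exact hxy huv.symm

theorem trimCompletion_chordal [Finite α] {G G' : SimpleGraph α} {Ω : Set α} {x y : α}
    (hch : ChordalG G') (hΩ : G'.IsClique Ω) (hx : x ∈ Ω) (hy : y ∈ Ω)
    (hsep : ∀ D, IsCompOf G (Set.univ \ Ω) D → x ∈ setNbhd G D → y ∉ setNbhd G D) :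
    ChordalG (trimCompletion G G' Ω x y) := by
  rintro H ⟨n, f, hn, hf, -⟩
  have hout : ∀ {D}, IsCompOf G (Set.univ \ Ω) D → ∀ {u}, u ∈ D → u ∉ Ω :=
    fun hD _ hu => (hD.1 hu).2
  have hclosed : ∀ {D}, IsCompOf G (Set.univ \ Ω) D → ∀ {u}, u ∈ Ω → u ∈ D ∪ setNbhd G D →
      u ∈ setNbhd G D := fun hD _ hu h => h.resolve_left fun h' => hout hD h' hu
  by_cases hall : ∀ i, f i ∈ Ω
  · have hpair : ∀ i, (f i = x ∧ f (i + 2) = y) ∨ (f i = y ∧ f (i + 2) = x) := by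
      intro i
      by_contra! hcon
      have hne : f i ≠ f (i + 2) := by
        intro h
        refine natCast_zmod_ne (n := n) (a := 0) (b := 2) (by omega) (by omega) ?_
        push_cast
        linear_combination hf.1 h
      have hadj : (trimCompletion G G' Ω x y).Adj (f i) (f (i + 2)) :=
        ⟨hΩ (hall _) (hall _) hne, fun h => hcon.1 h.1 h.2, fun h => hcon.2 h.1 h.2,
          fun D hD => ⟨fun h => absurd (hall _) (hout hD h),
            fun h => absurd (hall _) (hout hD h)⟩⟩
      rcases (hf.2 _ _).1 hadj with h | h
      · refine natCast_zmod_ne (n := n) (a := 0) (b := 3) (by omega) (by omega) ?_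
        push_cast
        linear_combination h
      · refine natCast_zmod_ne (n := n) (a := 1) (b := 2) (by omega) (by omega) ?_
        push_cast
        linear_combination -h
    have h01 : f 0 ≠ f 1 := by
      intro h
      refine natCast_zmod_ne (n := n) (a := 0) (b := 1) (by omega) (by omega) ?_
      push_cast
      exact hf.1 h
    have h12 : f 1 ≠ f 2 := by
      intro h
      refine natCast_zmod_ne (n := n) (a := 1) (b := 2) (by omega) (by omega) ?_
      push_cast
      exact hf.1 h
    have h0 := hpair 0
    have h1 := hpair 1
    rw [zero_add] at h0
    grind
  · push Not at hall
    obtain ⟨i₀, hi₀⟩ := hall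
    obtain ⟨D, hD, hiD⟩ := IsCompOf.exists_mem (G := G) (S := Set.univ \ Ω) ⟨trivial, hi₀⟩
    have hNΩ := setNbhd_comp_subset hD
    have hmem : ∀ i, f i ∈ D ∪ setNbhd G D := by
      refine hf.mem_of_clique_separates (K := trimCompletion G G' Ω x y) ?_ ?_ hn hiD
      · intro u hu v hv huv
        refine ⟨hΩ (hNΩ hu) (hNΩ hv) huv, ?_, ?_, fun E hE =>
          ⟨fun h => absurd (hNΩ hu) (hout hE h), fun h => absurd (hNΩ hv) (hout hE h)⟩⟩
        · rintro ⟨rfl, rfl⟩; exact hsep D hD hu hv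
        · rintro ⟨rfl, rfl⟩; exact hsep D hD hv hu
      · exact fun u hu v huv => (huv.2.2.2 D hD).1 hu
    refine hch (Set.range f) ⟨n, f, hn, ⟨hf.1, fun i j => ?_⟩, rfl⟩
    rw [← hf.2]
    refine ⟨fun h => ⟨h, ?_, ?_, fun E hE => ?_⟩, fun h => h.1⟩
    · rintro ⟨h1, h2⟩
      exact hsep D hD (hclosed hD hx (h1 ▸ hmem i)) (hclosed hD hy (h2 ▸ hmem j))
    · rintro ⟨h1, h2⟩
      exact hsep D hD (hclosed hD hx (h2 ▸ hmem j)) (hclosed hD hy (h1 ▸ hmem i))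
    · have key : ∀ {a b}, f a ∈ E → f b ∈ E ∪ setNbhd G E := by
        intro a b ha
        have haD : f a ∈ D := (hmem a).resolve_right fun h => hout hE ha (hNΩ h)
        rw [hE.eq_of_mem hD ha haD]
        exact hmem b
      exact ⟨key, key⟩

/-- Two non-adjacent vertices of a potential maximal clique `Ω` are both attached to some
component of `G ∖ Ω`. -/
theorem IsPMC.exists_comp [Finite α] {G : SimpleGraph α} {Ω : Set α} (h : IsPMC G Ω) {x y : α}
    (hx : x ∈ Ω) (hy : y ∈ Ω) (hne : x ≠ y) (hxy : ¬ G.Adj x y) :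
    ∃ D, IsCompOf G (Set.univ \ Ω) D ∧ x ∈ setNbhd G D ∧ y ∈ setNbhd G D := by
  by_contra! hcon
  obtain ⟨G', ⟨hle, hch, hmin⟩, hΩ, -⟩ := h
  have heq := hmin (trimCompletion G G' Ω x y) (le_trimCompletion hle hxy) (fun _ _ h => h.1)
    (trimCompletion_chordal hch hΩ hx hy hcon)
  have hadj : (trimCompletion G G' Ω x y).Adj x y := by
    rw [heq]
    exact hΩ hx hy hne
  exact hadj.2.1 ⟨rfl, rfl⟩

end PotentialMaximalCliques

section Thetas

variable {α : Type} {G : SimpleGraph α}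

theorem exists_inducedPath_through {S : Set α} {a b : α} (hS : ConnSet G S) (hab : a ≠ b)
    (hnadj : ¬ G.Adj a b) (ha : a ∈ setNbhd G S) (hb : b ∈ setNbhd G S) :
    ∃ (n : ℕ) (f : Fin n → α), 3 ≤ n ∧ IsPathFromTo G n f a b ∧
      ∀ u : Fin n, 0 < u.val → u.val < n - 1 → f u ∈ S := by
  obtain ⟨-, s, hs, has⟩ := ha
  obtain ⟨-, t, ht, hbt⟩ := hb
  have hconn : (G.induce ((S ∪ {s, a}) ∪ {t, b})).Connected := by
    refine SimpleGraph.induce_union_connected (SimpleGraph.induce_union_connected hS.preconnected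
      (SimpleGraph.induce_pair_connected_of_adj has.symm).preconnected
        ⟨s, hs, by simp⟩).preconnected
      (SimpleGraph.induce_pair_connected_of_adj hbt.symm).preconnected ⟨t, Or.inl ht, by simp⟩
  set W : Set α := (S ∪ {s, a}) ∪ {t, b} with hW
  have hWmem : ∀ w ∈ W, w ≠ a → w ≠ b → w ∈ S := by
    rintro w ((h | rfl | rfl) | rfl | rfl) h1 h2 <;> first | assumption | exact absurd rfl ‹_›
  have haW : a ∈ W := by simp [hW]
  have hbW : b ∈ W := by simp [hW]
  obtain ⟨p, hp⟩ := hconn.exists_walk_length_eq_dist ⟨a, haW⟩ ⟨b, hbW⟩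
  set L := p.length with hL
  have hgap : ∀ i j, i ≤ L → j ≤ L →
      L ≤ i + (G.induce W).dist (p.getVert i) (p.getVert j) + (L - j) := by
    intro i j hi hj
    have h1 := (SimpleGraph.dist_le (p.take i)).trans_eq (p.take_length i)
    have h2 := (SimpleGraph.dist_le (p.drop j)).trans_eq (p.drop_length j)
    have h3 := hconn.dist_triangle (u := ⟨a, haW⟩) (v := p.getVert i) (w := ⟨b, hbW⟩)
    have h4 := hconn.dist_triangle (u := p.getVert i) (v := p.getVert j) (w := ⟨b, hbW⟩)
    omega
  have hinj : ∀ i j, i ≤ L → j ≤ L → p.getVert i = p.getVert j → i = j := by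
    intro i j hi hj h
    have h1 := hgap i j hi hj
    have h2 := hgap j i hj hi
    rw [h, SimpleGraph.dist_self] at h1 h2
    omega
  have hchord : ∀ i j, i ≤ L → j ≤ L → (G.induce W).Adj (p.getVert i) (p.getVert j) →
      i = j + 1 ∨ j = i + 1 := by
    intro i j hi hj h
    have h1 := hgap i j hi hj
    have h2 := hgap j i hj hi
    rw [SimpleGraph.dist_eq_one_iff_adj.2 h] at h1
    rw [SimpleGraph.dist_eq_one_iff_adj.2 h.symm] at h2
    have : i ≠ j := fun e => h.ne (by rw [e])
    omega
  have hL0 : L ≠ 0 := by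
    intro h
    have := p.getVert_length
    rw [← hL, h, p.getVert_zero] at this
    exact hab (congrArg Subtype.val this)
  have hL1 : L ≠ 1 := by
    intro h
    have h1 := p.adj_getVert_succ (i := 0) (by omega)
    have h2 := p.getVert_length
    rw [← hL, h] at h2
    rw [p.getVert_zero, zero_add, h2] at h1
    exact hnadj h1
  refine ⟨L + 1, fun i => (p.getVert i.val).val, by omega, ⟨⟨?_, ?_⟩, by omega, ?_, ?_⟩, ?_⟩
  · intro i j h
    exact Fin.ext (hinj _ _ (by omega) (by omega) (Subtype.ext h))
  · intro i j
    refine ⟨fun h => hchord _ _ (by omega) (by omega) h, ?_⟩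
    rintro (h | h)
    · have := p.adj_getVert_succ (i := j.val) (by omega)
      rw [← h] at this
      exact this.symm
    · have := p.adj_getVert_succ (i := i.val) (by omega)
      rw [← h] at this
      exact this
  · simp
  · simp [hL]
  · intro u hu0 huL
    refine hWmem _ (p.getVert u.val).2 (fun h => ?_) (fun h => ?_)
    · have := hinj u.val 0 (by omega) (by omega) (Subtype.ext (by simpa using h))
      omega
    · have := hinj u.val L (by omega) le_rfl (Subtype.ext (by simpa [hL] using h))
      omega

/-- `A` and `B` are disjoint and anticomplete to each other. -/
def Apart (G : SimpleGraph α) (A B : Set α) : Prop :=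
  ∀ a ∈ A, ∀ b ∈ B, a ≠ b ∧ ¬ G.Adj a b

theorem Apart.symm {A B : Set α} (h : Apart G A B) : Apart G B A :=
  fun b hb a ha => ⟨(h a ha b hb).1.symm, fun e => (h a ha b hb).2 e.symm⟩

theorem Apart.union_left {A B C : Set α} (h : Apart G A C) (h' : Apart G B C) :
    Apart G (A ∪ B) C := by
  rintro a (ha | ha)
  exacts [h a ha, h' a ha]

theorem hasTheta_of_apart {a b : α} (hab : a ≠ b) (hnadj : ¬ G.Adj a b) {S₁ S₂ S₃ : Set α}
    (h₁ : ConnSet G S₁) (h₂ : ConnSet G S₂) (h₃ : ConnSet G S₃)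
    (ha₁ : a ∈ setNbhd G S₁) (ha₂ : a ∈ setNbhd G S₂) (ha₃ : a ∈ setNbhd G S₃)
    (hb₁ : b ∈ setNbhd G S₁) (hb₂ : b ∈ setNbhd G S₂) (hb₃ : b ∈ setNbhd G S₃)
    (h₁₂ : Apart G S₁ S₂) (h₁₃ : Apart G S₁ S₃) (h₂₃ : Apart G S₂ S₃) : HasTheta G := by
  have hall : ∀ i, ∃ (n : ℕ) (f : Fin n → α), 3 ≤ n ∧ IsPathFromTo G n f a b ∧
      ∀ u : Fin n, 0 < u.val → u.val < n - 1 → f u ∈ ![S₁, S₂, S₃] i := by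
    intro i
    fin_cases i
    · exact exists_inducedPath_through h₁ hab hnadj ha₁ hb₁
    · exact exists_inducedPath_through h₂ hab hnadj ha₂ hb₂
    · exact exists_inducedPath_through h₃ hab hnadj ha₃ hb₃
  have hapart : ∀ i j : Fin 3, i ≠ j → Apart G (![S₁, S₂, S₃] i) (![S₁, S₂, S₃] j) := by
    intro i j hij
    fin_cases i <;> fin_cases j <;>
      first
        | exact absurd rfl hij
        | exact h₁₂
        | exact h₁₃
        | exact h₂₃
        | exact h₁₂.symm
        | exact h₁₃.symm
        | exact h₂₃.symm
  choose n f hn hf hin using hall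
  exact ⟨a, b, n, f, hab, hnadj, hn, hf, fun i j hij u v hu hu' hv hv' =>
    hapart i j hij _ (hin i u hu hu') _ (hin j v hv hv')⟩

theorem IsCompOf.apart {S D D' : Set α} (hD : IsCompOf G S D) (hD' : IsCompOf G S D')
    (hne : D ≠ D') : Apart G D D' :=
  fun _ ha _ hb => ⟨fun e => hne (hD.eq_of_mem hD' ha (e ▸ hb)),
    fun h => hne (hD.eq_of_mem hD' (hD.mem_of_adj ha (hD'.1 hb) h) hb)⟩

theorem IsCompOf.apart_singleton {Ω D : Set α} (hD : IsCompOf G (Set.univ \ Ω) D) {x : α}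
    (hx : x ∈ Ω) (hxD : x ∉ setNbhd G D) : Apart G D {x} := by
  intro a ha b hb
  rw [Set.mem_singleton_iff.1 hb]
  have hxD' : x ∉ D := fun h => (hD.1 h).2 hx
  exact ⟨fun e => hxD' (e ▸ ha), fun h => hxD ⟨hxD', a, ha, h.symm⟩⟩

theorem ConnSet.bridge {D D' : Set α} {x : α} (hD : ConnSet G D) (hD' : ConnSet G D')
    (hx : x ∈ setNbhd G D) (hx' : x ∈ setNbhd G D') : ConnSet G (D ∪ {x} ∪ D') := by
  obtain ⟨-, d, hd, hxd⟩ := hx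
  obtain ⟨-, d', hd', hxd'⟩ := hx'
  have hsing : (G.induce {x}).Preconnected := SimpleGraph.Preconnected.of_subsingleton
  have := SimpleGraph.connected_induce_union hD.preconnected hsing hd rfl hxd.symm
  exact SimpleGraph.connected_induce_union this.preconnected hD'.preconnected
    (Or.inr rfl) hd' hxd'

theorem mem_setNbhd_bridge_left {Ω D D' : Set α} {a x : α} (ha : a ∈ Ω)
    (hD' : IsCompOf G (Set.univ \ Ω) D') (hax : a ≠ x) (haD : a ∈ setNbhd G D) :
    a ∈ setNbhd G (D ∪ {x} ∪ D') := by
  obtain ⟨h, d, hd, had⟩ := haD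
  refine ⟨?_, d, Or.inl (Or.inl hd), had⟩
  rintro ((h' | h') | h')
  exacts [h h', hax h', (hD'.1 h').2 ha]

theorem mem_setNbhd_bridge_right {Ω D D' : Set α} {a x : α} (ha : a ∈ Ω)
    (hD : IsCompOf G (Set.univ \ Ω) D) (hax : a ≠ x) (haD' : a ∈ setNbhd G D') :
    a ∈ setNbhd G (D ∪ {x} ∪ D') := by
  obtain ⟨h, d, hd, had⟩ := haD'
  refine ⟨?_, d, Or.inr hd, had⟩
  rintro ((h' | h') | h')
  exacts [(hD.1 h').2 ha, hax h', h h']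

theorem hasTheta_of_three_comps {Ω P Q R : Set α} {a b : α} (hab : a ≠ b) (hnadj : ¬ G.Adj a b)
    (hP : IsCompOf G (Set.univ \ Ω) P) (hQ : IsCompOf G (Set.univ \ Ω) Q)
    (hR : IsCompOf G (Set.univ \ Ω) R) (hPQ : P ≠ Q) (hPR : P ≠ R) (hQR : Q ≠ R)
    (haP : a ∈ setNbhd G P) (hbP : b ∈ setNbhd G P) (haQ : a ∈ setNbhd G Q)
    (hbQ : b ∈ setNbhd G Q) (haR : a ∈ setNbhd G R) (hbR : b ∈ setNbhd G R) : HasTheta G :=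
  hasTheta_of_apart hab hnadj hP.2.1 hQ.2.1 hR.2.1 haP haQ haR hbP hbQ hbR
    (hP.apart hQ hPQ) (hP.apart hR hPR) (hQ.apart hR hQR)

/-- Two components attached to `a`, `b` but not to `c`, together with a path from `a` to `b`
through `c`, make a theta. -/
theorem hasTheta_of_bridge {Ω P Q R R' : Set α} {a b c : α} (ha : a ∈ Ω) (hb : b ∈ Ω)
    (hc : c ∈ Ω) (hab : a ≠ b) (hac : a ≠ c) (hbc : b ≠ c) (hnadj : ¬ G.Adj a b)
    (hP : IsCompOf G (Set.univ \ Ω) P) (hQ : IsCompOf G (Set.univ \ Ω) Q)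
    (hR : IsCompOf G (Set.univ \ Ω) R) (hR' : IsCompOf G (Set.univ \ Ω) R') (hPQ : P ≠ Q)
    (haP : a ∈ setNbhd G P) (hbP : b ∈ setNbhd G P) (hcP : c ∉ setNbhd G P)
    (haQ : a ∈ setNbhd G Q) (hbQ : b ∈ setNbhd G Q) (hcQ : c ∉ setNbhd G Q)
    (haR : a ∈ setNbhd G R) (hcR : c ∈ setNbhd G R)
    (hbR' : b ∈ setNbhd G R') (hcR' : c ∈ setNbhd G R') : HasTheta G := by
  have hapart : ∀ {E}, IsCompOf G (Set.univ \ Ω) E → c ∉ setNbhd G E →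
      Apart G E (R ∪ {c} ∪ R') := fun {E} hE hcE =>
    (((hR.apart hE fun e => hcE (e ▸ hcR)).union_left (hE.apart_singleton hc hcE).symm).union_left
      (hR'.apart hE fun e => hcE (e ▸ hcR'))).symm
  exact hasTheta_of_apart hab hnadj hP.2.1 hQ.2.1 (hR.2.1.bridge hR'.2.1 hcR hcR') haP haQ
    (mem_setNbhd_bridge_left ha hR' hac haR) hbP hbQ (mem_setNbhd_bridge_right hb hR hbc hbR')
    (hP.apart hQ hPQ) (hapart hP hcP) (hapart hQ hcQ)

end Thetas

theorem exists_comps_cover {α : Type} {G : SimpleGraph α} (hθ : ¬ HasTheta G) {Ω Y : Set α}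
    (hYΩ : Y ⊆ Ω) (hstable : StableSet G Y) (hY : Y.Nontrivial)
    (hpair : ∀ x ∈ Y, ∀ y ∈ Y, x ≠ y →
      ∃ D, IsCompOf G (Set.univ \ Ω) D ∧ x ∈ setNbhd G D ∧ y ∈ setNbhd G D) :
    ∃ D : Fin 3 → Set α, (∀ i, IsCompOf G (Set.univ \ Ω) (D i)) ∧
      Y ⊆ ⋃ i, setNbhd G (D i) := by
  have hpack : ∀ {P Q R : Set α}, IsCompOf G (Set.univ \ Ω) P → IsCompOf G (Set.univ \ Ω) Q →
      IsCompOf G (Set.univ \ Ω) R →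
      (∀ u ∈ Y, u ∈ setNbhd G P ∨ u ∈ setNbhd G Q ∨ u ∈ setNbhd G R) →
      ∃ D : Fin 3 → Set α, (∀ i, IsCompOf G (Set.univ \ Ω) (D i)) ∧
        Y ⊆ ⋃ i, setNbhd G (D i) := by
    intro P Q R hP hQ hR h
    refine ⟨![P, Q, R], fun i => by fin_cases i <;> assumption, fun u hu => ?_⟩
    rcases h u hu with h | h | h
    exacts [Set.mem_iUnion.2 ⟨0, h⟩, Set.mem_iUnion.2 ⟨1, h⟩, Set.mem_iUnion.2 ⟨2, h⟩]
  by_cases htriple : ∀ w ∈ Y, ∀ x ∈ Y, ∀ y ∈ Y, ∃ D, IsCompOf G (Set.univ \ Ω) D ∧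
      w ∈ setNbhd G D ∧ x ∈ setNbhd G D ∧ y ∈ setNbhd G D
  · obtain ⟨w, hw, x, hx, hwx⟩ := hY
    obtain ⟨P, hP, hwP, hxP⟩ := hpair w hw x hx hwx
    by_cases hQ : ∃ Q, IsCompOf G (Set.univ \ Ω) Q ∧ w ∈ setNbhd G Q ∧ x ∈ setNbhd G Q ∧ Q ≠ P
    · obtain ⟨Q, hQ, hwQ, hxQ, hQP⟩ := hQ
      refine hpack hP hQ hQ fun u hu => ?_
      obtain ⟨R, hR, hwR, hxR, huR⟩ := htriple w hw x hx u hu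
      by_cases hRP : R = P
      · exact Or.inl (hRP ▸ huR)
      by_cases hRQ : R = Q
      · exact Or.inr (Or.inl (hRQ ▸ huR))
      exact absurd (hasTheta_of_three_comps hwx (hstable w hw x hx hwx) hR hP hQ hRP hRQ hQP.symm
        hwR hxR hwP hxP hwQ hxQ) hθ
    · refine hpack hP hP hP fun u hu => ?_
      obtain ⟨R, hR, hwR, hxR, huR⟩ := htriple w hw x hx u hu
      by_cases hRP : R = P
      · exact Or.inl (hRP ▸ huR)
      exact absurd ⟨R, hR, hwR, hxR, hRP⟩ hQ
  · push Not at htriple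
    obtain ⟨w, hw, x, hx, y, hy, hno⟩ := htriple
    have hwx : w ≠ x := by
      rintro rfl
      by_cases hwy : w = y
      · subst hwy
        obtain ⟨z, hz, hzw⟩ := hY.exists_ne w
        obtain ⟨D, hD, hwD, -⟩ := hpair w hw z hz hzw.symm
        exact hno D hD hwD hwD hwD
      · obtain ⟨D, hD, hwD, hyD⟩ := hpair w hw y hy hwy
        exact hno D hD hwD hwD hyD
    have hxy : x ≠ y := by
      rintro rfl
      obtain ⟨D, hD, hwD, hxD⟩ := hpair w hw x hx hwx
      exact hno D hD hwD hxD hxD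
    have hwy : w ≠ y := by
      rintro rfl
      obtain ⟨D, hD, hwD, hxD⟩ := hpair w hw x hx hwx
      exact hno D hD hwD hxD hwD
    obtain ⟨A, hA, hwA, hxA⟩ := hpair w hw x hx hwx
    obtain ⟨B, hB, hwB, hyB⟩ := hpair w hw y hy hwy
    obtain ⟨C, hC, hxC, hyC⟩ := hpair x hx y hy hxy
    have hyA : y ∉ setNbhd G A := hno A hA hwA hxA
    have hxB : x ∉ setNbhd G B := fun h => hno B hB hwB h hyB
    have hwC : w ∉ setNbhd G C := fun h => hno C hC h hxC hyC
    refine hpack hA hB hC fun u hu => ?_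
    by_contra! hcon
    obtain ⟨huA, huB, huC⟩ := hcon
    have hwx_only : ∀ F, IsCompOf G (Set.univ \ Ω) F → u ∈ setNbhd G F → w ∈ setNbhd G F →
        x ∉ setNbhd G F := fun F hF huF hwF hxF =>
      hθ (hasTheta_of_bridge (hYΩ hw) (hYΩ hx) (hYΩ hy) hwx hwy hxy (hstable w hw x hx hwx)
        hF hA hB hC (fun e => huA (e ▸ huF)) hwF hxF (hno F hF hwF hxF) hwA hxA hyA hwB hyB
        hxC hyC)
    have hwy_only : ∀ F, IsCompOf G (Set.univ \ Ω) F → u ∈ setNbhd G F → w ∈ setNbhd G F →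
        y ∉ setNbhd G F := fun F hF huF hwF hyF =>
      hθ (hasTheta_of_bridge (hYΩ hw) (hYΩ hy) (hYΩ hx) hwy hwx hxy.symm (hstable w hw y hy hwy)
        hF hB hA hC (fun e => huB (e ▸ huF)) hwF hyF (fun h => hno F hF hwF h hyF) hwB hyB hxB
        hwA hxA hyC hxC)
    have hxy_only : ∀ F, IsCompOf G (Set.univ \ Ω) F → u ∈ setNbhd G F → x ∈ setNbhd G F →
        y ∉ setNbhd G F := fun F hF huF hxF hyF =>
      hθ (hasTheta_of_bridge (hYΩ hx) (hYΩ hy) (hYΩ hw) hxy hwx.symm hwy.symm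
        (hstable x hx y hy hxy) hF hC hA hB (fun e => huC (e ▸ huF)) hxF hyF
        (fun h => hno F hF h hxF hyF) hxC hyC hwC hxA hwA hyB hwB)
    have huw : u ≠ w := fun e => huA (e ▸ hwA)
    have hux : u ≠ x := fun e => huA (e ▸ hxA)
    have huy : u ≠ y := fun e => huB (e ▸ hyB)
    obtain ⟨F, hF, huF, hwF⟩ := hpair u hu w hw huw
    obtain ⟨A', hA', huA', hxA'⟩ := hpair u hu x hx hux
    obtain ⟨B', hB', huB', hyB'⟩ := hpair u hu y hy huy
    have hxF := hwx_only F hF huF hwF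
    have hyF := hwy_only F hF huF hwF
    have hyA' := hxy_only A' hA' huA' hxA'
    have hxB' : x ∉ setNbhd G B' := fun h => hxy_only B' hB' huB' h hyB'
    have hFx : Apart G F (A ∪ {x} ∪ A') :=
      (((hA.apart hF fun e => hxF (e ▸ hxA)).union_left
        (hF.apart_singleton (hYΩ hx) hxF).symm).union_left
        (hA'.apart hF fun e => hxF (e ▸ hxA'))).symm
    have hFy : Apart G F (B ∪ {y} ∪ B') :=
      (((hB.apart hF fun e => hyF (e ▸ hyB)).union_left
        (hF.apart_singleton (hYΩ hy) hyF).symm).union_left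
        (hB'.apart hF fun e => hyF (e ▸ hyB'))).symm
    have hAy : ∀ {E}, IsCompOf G (Set.univ \ Ω) E → y ∉ setNbhd G E →
        Apart G E (B ∪ {y} ∪ B') := fun {E} hE hyE =>
      (((hB.apart hE fun e => hyE (e ▸ hyB)).union_left
        (hE.apart_singleton (hYΩ hy) hyE).symm).union_left
        (hB'.apart hE fun e => hyE (e ▸ hyB'))).symm
    have hxy_apart : Apart G {x} (B ∪ {y} ∪ B') := by
      refine (((hB.apart_singleton (hYΩ hx) hxB).union_left ?_).union_left
        (hB'.apart_singleton (hYΩ hx) hxB')).symm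
      rintro _ rfl _ rfl
      exact ⟨hxy.symm, hstable _ hy _ hx hxy.symm⟩
    exact hθ (hasTheta_of_apart huw.symm (hstable w hw u hu huw.symm) hF.2.1
      (hA.2.1.bridge hA'.2.1 hxA hxA') (hB.2.1.bridge hB'.2.1 hyB hyB') hwF
      (mem_setNbhd_bridge_left (hYΩ hw) hA' hwx hwA) (mem_setNbhd_bridge_left (hYΩ hw) hB' hwy hwB)
      huF (mem_setNbhd_bridge_right (hYΩ hu) hA hux huA')
      (mem_setNbhd_bridge_right (hYΩ hu) hB huy huB') hFx hFy
      (((hAy hA hyA).union_left hxy_apart).union_left (hAy hA' hyA')))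

/-- in a structured tree decomposition of a graph of `𝒞`, every stable subset
of a bag is covered by the neighborhoods of at most 4 components of `G ∖ χ(v)`. -/
theorem stmt_15 {V ι : Type} [Fintype V] (G : SimpleGraph V) (hC : MemC G)
    (T : SimpleGraph ι) (χ : ι → Set V) (hT : StructuredTD G T χ)
    (v : ι) (Y : Set V) (hY : Y ⊆ χ v) (hstable : StableSet G Y)
    (h2 : 2 ≤ Y.ncard) :
    ∃ (kk : ℕ) (D : Fin kk → Set V), kk ≤ 4 ∧
      (∀ i, IsCompOf G (Set.univ \ χ v) (D i)) ∧
      Y ⊆ ⋃ i, setNbhd G (D i) := by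
  have hYn : Y.Nontrivial := Set.one_lt_ncard_iff_nontrivial.1 h2
  obtain ⟨D, hD, hcover⟩ := exists_comps_cover hC.2.1 hY hstable hYn fun x hx y hy hne =>
    (hT.2 v).exists_comp (hY hx) (hY hy) hne (hstable x hx y hy hne)
  exact ⟨3, D, by norm_num, hD, hcover⟩
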